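/- Let G be a finite simple graph on vertex set V with at least one edge, let A be its adjacency matrix, and let λ_max and λ_min denote the largest and smallest eigenvalues of A. Then the chromatic number of G satisfies χ(G) ≥ 1 − λ_max/λ_min. -/

import Mathlib

lemma adjMatrix_isHermitian {V : Type*} [Fintype V] (G : SimpleGraph V)
    [DecidableRel G.Adj] : (G.adjMatrix ℝ).IsHermitian := by
  rw [Matrix.IsHermitian, Matrix.conjTranspose_eq_transpose_of_trivial]
  exact G.isSymm_adjMatrix

open Matrix in
lemma hoffman_quad {V : Type*} [Fintype V] [DecidableEq V] (A : Matrix V V ℝ)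
    (hA : A.IsHermitian) (m : ℝ) (hm : ∀ i, m ≤ hA.eigenvalues i) (y : V → ℝ) :
    m * (y ⬝ᵥ y) ≤ y ⬝ᵥ (A *ᵥ y) := by
  have key : ∀ z w : V → ℝ, ∑ i, (z ⬝ᵥ ⇑(hA.eigenvectorBasis i)) *
      (w ⬝ᵥ ⇑(hA.eigenvectorBasis i)) = z ⬝ᵥ w := by
    intro z w
    have h := hA.eigenvectorBasis.sum_inner_mul_inner (WithLp.toLp 2 z) (WithLp.toLp 2 w)
    simp only [EuclideanSpace.inner_eq_star_dotProduct, star_trivial] at h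
    rw [dotProduct_comm z w, ← h]
    refine Finset.sum_congr rfl fun i _ => ?_
    rw [dotProduct_comm z]
  have h2 : ∀ i, (A *ᵥ y) ⬝ᵥ ⇑(hA.eigenvectorBasis i) =
      hA.eigenvalues i * (y ⬝ᵥ ⇑(hA.eigenvectorBasis i)) := by
    intro i
    have hT : Aᵀ = A := by
      have := hA.eq
      rwa [conjTranspose_eq_transpose_of_trivial] at this
    rw [← smul_eq_mul, ← dotProduct_smul, ← hA.mulVec_eigenvectorBasis i, dotProduct_mulVec,
      ← mulVec_transpose, hT]
  rw [← key y y, ← key y (A *ᵥ y), Finset.mul_sum]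
  refine Finset.sum_le_sum fun i _ => ?_
  rw [h2]
  nlinarith [mul_le_mul_of_nonneg_right (hm i) (mul_self_nonneg (y ⬝ᵥ ⇑(hA.eigenvectorBasis i)))]

open scoped Matrix

/-- **Hoffman's theorem.** For a finite simple graph `G` with at least one edge, with adjacency
matrix `A`, the chromatic number of `G` satisfies `χ(G) ≥ 1 - λ_max / λ_min`.  (Stated via:
every proper `k`-coloring forces `k ≥ 1 - λ_max / λ_min`.) -/
theorem hoffman {V : Type*} [Fintype V] [DecidableEq V] (G : SimpleGraph V)
    [DecidableRel G.Adj] (hedge : ∃ u v, G.Adj u v) :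
    ∀ k : ℕ, G.Colorable k →
      1 - (⨆ v, (adjMatrix_isHermitian G).eigenvalues v) /
          (⨅ v, (adjMatrix_isHermitian G).eigenvalues v) ≤ (k : ℝ) := by
  intro k ⟨C⟩
  set hA := adjMatrix_isHermitian G
  obtain ⟨a, b, hab⟩ := hedge
  have : Nonempty V := ⟨a⟩
  set m := ⨅ v, hA.eigenvalues v with hmdef
  have hm : ∀ i, m ≤ hA.eigenvalues i := fun i => ciInf_le (Set.finite_range _).bddBelow i
  have hq := hoffman_quad _ hA m hm
  have hne : a ≠ b := hab.ne
  have hneg : m < 0 := by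
    have h := hq (Pi.single a 1 - Pi.single b 1)
    simp [Matrix.mulVec_sub, sub_dotProduct, dotProduct_sub, hne, hne.symm, hab, hab.symm] at h
    linarith
  have hk : (0 : ℝ) < k := by
    have : 0 < k := Fin.pos (C a)
    exact_mod_cast this
  obtain ⟨j, hj⟩ := exists_eq_ciSup_of_finite (f := hA.eigenvalues)
  rw [← hj]
  set M := hA.eigenvalues j
  set x : V → ℝ := ⇑(hA.eigenvectorBasis j) with hx
  have hxx : x ⬝ᵥ x = 1 := by
    have h := hA.eigenvectorBasis.orthonormal.1 j
    have h' := real_inner_self_eq_norm_sq (hA.eigenvectorBasis j)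
    rw [h] at h'
    rw [EuclideanSpace.inner_eq_star_dotProduct, one_pow, star_trivial] at h'
    exact h'
  have hxA : x ⬝ᵥ (G.adjMatrix ℝ *ᵥ x) = M := by
    rw [hA.mulVec_eigenvectorBasis j, dotProduct_smul, hxx]
    simp [M]
  let t : Fin k → V → ℝ := fun c v => 1 - k * (if c = C v then 1 else 0)
  have ht : ∀ u v, ∑ c, t c u * t c v = -k + k ^ 2 * (if C u = C v then 1 else 0) := by
    intro u v
    have : ∀ c, t c u * t c v = 1 - k * (if c = C u then 1 else 0) -
        k * (if c = C v then 1 else 0) +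
        k ^ 2 * (if c = C u then (if C u = C v then 1 else 0) else 0) := by
      intro c
      simp only [t]
      split_ifs <;> first | ring1 | (exfalso; simp_all)
    simp only [this, Finset.sum_add_distrib, Finset.sum_sub_distrib, ← Finset.mul_sum,
      Finset.sum_ite_eq', Finset.sum_ite_eq, Finset.mem_univ, if_true]
    simp
  have h1 : ∑ c, (fun v => t c v * x v) ⬝ᵥ (fun v => t c v * x v) = k ^ 2 - k := by
    simp only [dotProduct]
    rw [Finset.sum_comm]
    have : ∀ v, ∑ c, t c v * x v * (t c v * x v) = (k ^ 2 - k) * (x v * x v) := by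
      intro v
      have h := ht v v
      simp only [if_true] at h
      calc _ = (∑ c, t c v * t c v) * (x v * x v) := by
            rw [Finset.sum_mul]
            exact Finset.sum_congr rfl fun c _ => by ring
        _ = _ := by rw [h]; ring
    simp only [this, ← Finset.mul_sum]
    simp only [dotProduct] at hxx
    rw [hxx, mul_one]
  have h2 : ∑ c, (fun v => t c v * x v) ⬝ᵥ (G.adjMatrix ℝ *ᵥ (fun v => t c v * x v)) =
      -k * M := by
    rw [← hxA]
    simp only [dotProduct, Matrix.mulVec, Finset.mul_sum]
    rw [Finset.sum_comm]
    refine Finset.sum_congr rfl fun u _ => ?_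
    rw [Finset.sum_comm]
    refine Finset.sum_congr rfl fun v _ => ?_
    calc _ = (∑ c, t c u * t c v) * (x u * (G.adjMatrix ℝ u v * x v)) := by
          rw [Finset.sum_mul]
          exact Finset.sum_congr rfl fun c _ => by ring
      _ = _ := by
          rw [ht]
          by_cases h : G.Adj u v
          · simp [C.valid h]
          · simp [h]
  have h3 : m * (k ^ 2 - k) ≤ -k * M := by
    rw [← h1, ← h2, Finset.mul_sum]
    exact Finset.sum_le_sum fun c _ => hq _
  have h4 : m * (k - 1) ≤ -M := by
    refine le_of_mul_le_mul_left ?_ hk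
    linarith
  have h5 : -(M / m) ≤ k - 1 := by
    rw [← neg_div, div_le_iff_of_neg hneg]
    linarith
  linarith
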